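/- Let N be an odd positive integer, k a positive even integer, f : ℍ → ℂ, a₂ ∈ ℂ, and ε ∈ {+1,−1}. If f|_k P = f, f|_k H_N = ε f, and f|_k T₂ = a₂ f, then f|_k M₂ = f, where M₂ = ((2,1),(N,(N+1)/2)). (Lemma 2.) -/

import Mathlib

open UpperHalfPlane Matrix Complex MatrixGroups Asymptotics Filter Topology
open scoped Manifold

set_option synthInstance.maxHeartbeats 1000000 in
/-- Action of a real 2×2 matrix with positive determinant on the upper
half-plane `ℍ` (junk value `z` if the determinant is not positive). -/
noncomputable def glAct (γ : Matrix (Fin 2) (Fin 2) ℝ) (z : ℍ) : ℍ :=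
  if h : 0 < γ.det then
    (⟨Matrix.GeneralLinearGroup.mkOfDetNeZero γ h.ne', by
        simpa [Matrix.GeneralLinearGroup.mkOfDetNeZero] using h⟩ : GL(2, ℝ)⁺) • z
  else z

/-- For an even integer `k`, the weight-`k` slash action
`(f ∣ₖ γ)(z) = (det γ)^(k/2) (cz+d)^(-k) f(γz)`. -/
noncomputable def slash (k : ℤ) (γ : Matrix (Fin 2) (Fin 2) ℝ) (f : ℍ → ℂ) : ℍ → ℂ :=
  fun z => (γ.det : ℂ) ^ (k / 2) * (γ 1 0 * (z : ℂ) + γ 1 1) ^ (-k) * f (glAct γ z)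

/-- An element of `SL(2, ℤ)` as a real matrix. -/
def sl2ToReal (γ : Matrix.SpecialLinearGroup (Fin 2) ℤ) : Matrix (Fin 2) (Fin 2) ℝ :=
  (γ : Matrix (Fin 2) (Fin 2) ℤ).map (Int.cast)

/-- The function `f(z) = Σ_{n ≥ 1} a_n e^{2πinz}` on the upper half-plane. -/
noncomputable def fourierSeries (a : ℕ → ℂ) : ℍ → ℂ :=
  fun z => ∑' n : ℕ, a (n + 1) *
    Complex.exp (2 * (Real.pi : ℂ) * Complex.I * ((n : ℂ) + 1) * (z : ℂ))

/-- The Dirichlet series `F(s) = Σ_{n ≥ 1} a_n n^{-s}`. -/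
noncomputable def dirichletSeries (a : ℕ → ℂ) (s : ℂ) : ℂ :=
  ∑' n : ℕ, a (n + 1) / ((n : ℂ) + 1) ^ s

/-- The action of the Hecke operator `T_p` in weight `k`:
`f|_k T_p = f|_k ((p,0),(0,1)) + Σ_{b=0}^{p-1} f|_k ((1,b),(0,p))`. -/
noncomputable def heckeT (k : ℤ) (p : ℕ) (f : ℍ → ℂ) : ℍ → ℂ :=
  fun z => slash k !![(p : ℝ), 0; 0, 1] f z +
    ∑ b ∈ Finset.range p, slash k !![1, (b : ℝ); 0, (p : ℝ)] f z

/-- The action of the Atkin–Lehner operator `U_q` in weight `k`: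
`f|_k U_q = Σ_{b=0}^{q-1} f|_k ((q,b),(0,q))`. -/
noncomputable def atkinLehnerU (k : ℤ) (q : ℕ) (f : ℍ → ℂ) : ℍ → ℂ :=
  fun z => ∑ b ∈ Finset.range q, slash k !![(q : ℝ), (b : ℝ); 0, (q : ℝ)] f z

/-- The local factor at the prime `p` of an Euler product of degree 2,
level `N`, and weight `k`. -/
noncomputable def localFactor (a : ℕ → ℂ) (N : ℕ) (k : ℤ) (p : ℕ) (s : ℂ) : ℂ :=
  if p ∣ N then
    (if p ^ 2 ∣ N then 1 else (1 - (p : ℂ) ^ ((k : ℂ) / 2 - 1 - s))⁻¹)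
  else (1 - a p * (p : ℂ) ^ (-s) + (p : ℂ) ^ ((k : ℂ) - 1 - 2 * s))⁻¹

theorem glAct_mul (A B : Matrix (Fin 2) (Fin 2) ℝ) (hA : 0 < A.det) (hB : 0 < B.det) (z : ℍ) :
    glAct (A * B) z = glAct A (glAct B z) := by
  have hAB : 0 < (A * B).det := by rw [Matrix.det_mul]; exact mul_pos hA hB
  rw [glAct, glAct, glAct, dif_pos hAB, dif_pos hA, dif_pos hB, ← mul_smul]
  congr 1
  ext i j
  rfl

theorem coe_glAct (A : Matrix (Fin 2) (Fin 2) ℝ) (hA : 0 < A.det) (z : ℍ) :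
    (glAct A z : ℂ) = (A 0 0 * z + A 0 1) / (A 1 0 * z + A 1 1) := by
  rw [glAct, dif_pos hA]
  exact UpperHalfPlane.coe_smul_of_det_pos (by simpa [Matrix.GeneralLinearGroup.mkOfDetNeZero]) z

theorem denom_ne_zero_of_det_pos (A : Matrix (Fin 2) (Fin 2) ℝ) (hA : 0 < A.det) (z : ℍ) :
    (A 1 0 * z + A 1 1 : ℂ) ≠ 0 :=
  UpperHalfPlane.denom_ne_zero (Matrix.GeneralLinearGroup.mkOfDetNeZero A hA.ne') z

theorem slash_mul (k : ℤ) (A B : Matrix (Fin 2) (Fin 2) ℝ) (hA : 0 < A.det) (hB : 0 < B.det)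
    (f : ℍ → ℂ) : slash k (A * B) f = slash k B (slash k A f) := by
  funext z
  have hd := denom_ne_zero_of_det_pos B hB z
  have hcocycle : (((A * B) 1 0 : ℝ) * z + ((A * B) 1 1 : ℝ) : ℂ) =
      (B 1 0 * z + B 1 1) * (A 1 0 * (glAct B z : ℂ) + A 1 1) := by
    have hnum : (B 1 0 * z + B 1 1 : ℂ) * glAct B z = (B 0 0 * z + B 0 1 : ℂ) := by
      rw [coe_glAct B hB, mul_div_cancel₀ _ hd]
    simp only [Matrix.mul_apply, Fin.sum_univ_two]
    push_cast
    linear_combination -(A 1 0 : ℂ) * hnum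
  simp only [slash]
  rw [hcocycle, glAct_mul A B hA hB, Matrix.det_mul, Complex.ofReal_mul, mul_zpow, mul_zpow]
  ring

theorem slash_one (k : ℤ) (f : ℍ → ℂ) : slash k 1 f = f := by
  funext z
  have hact : glAct 1 z = z := by
    ext
    rw [coe_glAct 1 (by simp)]
    simp
  simp [slash, hact]

theorem slash_injective (k : ℤ) (A : Matrix (Fin 2) (Fin 2) ℝ) (hA : 0 < A.det) :
    Function.Injective (slash k A) := by
  have hinv : 0 < (A⁻¹).det := by
    rw [Matrix.det_nonsing_inv, Ring.inverse_eq_inv']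
    exact inv_pos.mpr hA
  intro f g hfg
  have h := congrArg (slash k A⁻¹) hfg
  rwa [← slash_mul k _ _ hA hinv, ← slash_mul k _ _ hA hinv,
    Matrix.mul_nonsing_inv A (isUnit_iff_ne_zero.mpr hA.ne'), slash_one, slash_one] at h

theorem slash_const_mul (k : ℤ) (A : Matrix (Fin 2) (Fin 2) ℝ) (c : ℂ) (f : ℍ → ℂ) :
    slash k A (fun z => c * f z) = fun z => c * slash k A f z := by
  funext z
  simp only [slash]
  ring

theorem slash_add (k : ℤ) (A : Matrix (Fin 2) (Fin 2) ℝ) (f g : ℍ → ℂ) :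
    slash k A (fun z => f z + g z) = fun z => slash k A f z + slash k A g z := by
  funext z
  simp only [slash]
  ring

/-- **Lemma 2.** If `f|_k P = f`, `f|_k H_N = ε f`, and `f|_k T₂ = a₂ f`,
then `f|_k M₂ = f` where `M₂ = ((2,1),(N,(N+1)/2))`. -/
theorem lemma_two
    (N : ℕ) (hNpos : 0 < N) (hNodd : Odd N)
    (k : ℤ) (hkpos : 0 < k) (hkeven : Even k)
    (f : ℍ → ℂ) (a₂ : ℂ) (ε : ℝ) (hε : ε = 1 ∨ ε = -1)
    (hP : slash k !![1, 1; 0, 1] f = f)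
    (hH : slash k !![0, -1; (N : ℝ), 0] f = fun z => (ε : ℂ) * f z)
    (hT₂ : heckeT k 2 f = fun z => a₂ * f z) :
    slash k !![2, 1; (N : ℝ), ((N : ℝ) + 1) / 2] f = f := by
  have hN : (0 : ℝ) < N := by exact_mod_cast hNpos
  have dH : 0 < (!![0, -1; (N : ℝ), 0] : Matrix (Fin 2) (Fin 2) ℝ).det := by
    simpa [Matrix.det_fin_two_of]
  have dS : 0 < (!![2, 0; 0, 1] : Matrix (Fin 2) (Fin 2) ℝ).det := by
    simp [Matrix.det_fin_two_of]
  have dU (b : ℝ) : 0 < (!![1, b; 0, 2] : Matrix (Fin 2) (Fin 2) ℝ).det := by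
    simp [Matrix.det_fin_two_of]
  have dP : 0 < (!![1, 1; 0, 1] : Matrix (Fin 2) (Fin 2) ℝ).det := by
    simp [Matrix.det_fin_two_of]
  have dM : 0 < (!![2, 1; (N : ℝ), ((N : ℝ) + 1) / 2] : Matrix (Fin 2) (Fin 2) ℝ).det := by
    rw [Matrix.det_fin_two_of]; linarith
  have hT : (fun z => slash k !![2, 0; 0, 1] f z +
      (slash k !![1, 0; 0, 2] f z + slash k !![1, 1; 0, 2] f z)) = fun z => a₂ * f z := by
    rw [← hT₂]
    funext z
    simp [heckeT, Finset.sum_range_succ]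
  have hshift : slash k !![1, 1; 0, 2] f = slash k !![1, -1; 0, 2] f := by
    conv_rhs => rw [← hP]
    rw [← slash_mul k _ _ dP (dU _)]
    congr 1
    ext i j
    fin_cases i <;> fin_cases j <;> norm_num [Matrix.mul_apply]
  have hSH : slash k !![0, -1; (N : ℝ), 0] (slash k !![2, 0; 0, 1] f) =
      fun z => (ε : ℂ) * slash k !![1, 0; 0, 2] f z := by
    rw [← slash_const_mul, ← hH, ← slash_mul k _ _ dS dH, ← slash_mul k _ _ dH (dU _)]
    simp
  have hUH : slash k !![0, -1; (N : ℝ), 0] (slash k !![1, 0; 0, 2] f) =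
      fun z => (ε : ℂ) * slash k !![2, 0; 0, 1] f z := by
    rw [← slash_const_mul, ← hH, ← slash_mul k _ _ (dU _) dH, ← slash_mul k _ _ dH dS]
    congr 1
    simp [mul_comm]
  have hBH : slash k !![0, -1; (N : ℝ), 0] (slash k !![1, -1; 0, 2] f) =
      fun z => (ε : ℂ) * slash k !![1, -1; 0, 2] f z := by
    have h := congrArg (slash k !![0, -1; (N : ℝ), 0]) hT
    rw [slash_add, slash_add, slash_const_mul, hH, hSH, hUH, hshift] at h
    funext z
    have h1 := congrFun h z
    have h2 := congrFun hT z
    simp only [hshift] at h1 h2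
    linear_combination h1 - (ε : ℂ) * h2
  apply slash_injective k _ (dU (-1))
  apply slash_injective k _ dH
  rw [hBH, ← slash_const_mul, ← hH, ← slash_mul k _ _ dH (dU _), ← slash_mul k _ _ dM (dU _),
    ← slash_mul k _ _ (by rw [Matrix.det_mul]; exact mul_pos dM (dU _)) dH]
  congr 1
  ext i j
  fin_cases i <;> fin_cases j <;> norm_num [Matrix.mul_apply]
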